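/- Suppose a corrective flip is performed on a •/◦/+-diagram (stones colored black iff they are uncrossings), and that pipes i and j are the two pipes crossing at the crossing tile involved in the flip. Then the only stones that change color when performing the corrective flip lie along pipes i and j, on the segments of those pipes between the plus and the crossing tile involved in the flip. -/

import Mathlib

namespace GoPaper

/-- Fillings of a box: black stone, white stone, or plus. -/
inductive Fill : Type
  | black | white | plus
deriving DecidableEq

/-- A Ferrers shape inside the `k × (n-k)` rectangle (rows indexed from the top by
`0,…,k-1`, columns from the left by `0,…,n-k-1`), given by its set of boxes,
which is closed to the northwest. -/
structure Shape (n k : ℕ) where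
  boxes : Finset (ℕ × ℕ)
  row_lt : ∀ b ∈ boxes, b.1 < k
  col_lt : ∀ b ∈ boxes, b.2 < n - k
  nw_closed : ∀ b ∈ boxes, ∀ r c : ℕ, r ≤ b.1 → c ≤ b.2 → (r, c) ∈ boxes

/-- A `•/◦/+`-diagram: a Ferrers shape together with a filling of its boxes. -/
structure Diagram (n k : ℕ) where
  S : Shape n k
  fill : ℕ × ℕ → Fill

/-- `inIn b c` means `c ∈ b^in`, i.e. `c` is weakly to the right of and weakly below `b`. -/
def inIn (b c : ℕ × ℕ) : Prop := b.1 ≤ c.1 ∧ b.2 ≤ c.2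

instance (b c : ℕ × ℕ) : Decidable (inIn b c) := by unfold inIn; infer_instance

/-- The simple transposition `s_i` (0-indexed), as a permutation of `ℕ`. -/
def sw (i : ℕ) : Equiv.Perm ℕ := Equiv.swap i (i + 1)

/-- The (0-indexed) index of the simple transposition labelling box `b`:
the top-left box `(0,0)` is labelled `n-k-1`, indices decrease to the right and
increase downward. -/
def lab (n k : ℕ) (b : ℕ × ℕ) : ℕ := n - k - 1 + b.1 - b.2

/-- The simple transposition labelling box `b`. -/
def sbox (n k : ℕ) (b : ℕ × ℕ) : Equiv.Perm ℕ := sw (lab n k b)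

/-- Coxeter length of a permutation of `S_n` (supported on `{0,…,n-1}`): the
number of inversions. -/
def len (n : ℕ) (π : Equiv.Perm ℕ) : ℕ :=
  ((Finset.range n ×ˢ Finset.range n).filter (fun p => p.1 < p.2 ∧ π p.2 < π p.1)).card

/-- A canonical reading order on the boxes of a shape: rows from bottom to top,
each row from right to left (a valid reading order; all notions read off in a
reading order are independent of its choice). -/
def readingList {n k : ℕ} (S : Shape n k) : List (ℕ × ℕ) :=
  (((List.range k).reverse).flatMap fun r =>
      ((List.range (n - k)).reverse).map fun c => (r, c)).filter
    (fun b => decide (b ∈ S.boxes))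

/-- Product, in the reading order, of the box transpositions over boxes satisfying `p`. -/
def readProd {n k : ℕ} (D : Diagram n k) (p : ℕ × ℕ → Bool) : Equiv.Perm ℕ :=
  (((readingList D.S).filter p).map fun b => sbox n k b).prod

/-- The permutation `u` of the pipe dream of `D`: product of labels of the stone boxes. -/
def permU {n k : ℕ} (D : Diagram n k) : Equiv.Perm ℕ :=
  readProd D (fun b => decide (D.fill b ≠ Fill.plus))

/-- The Grassmannian permutation `v = v_λ`: product of labels of all boxes. -/
def permV {n k : ℕ} (D : Diagram n k) : Equiv.Perm ℕ := readProd D (fun _ => true)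

/-- `u_{b^in}^D`: product of the labels of the stone boxes of `b^in` other than `b`. -/
def uIn {n k : ℕ} (D : Diagram n k) (b : ℕ × ℕ) : Equiv.Perm ℕ :=
  readProd D (fun c => decide (inIn b c ∧ c ≠ b ∧ D.fill c ≠ Fill.plus))

/-- `v_{b^in}`: product of the labels of all boxes of `b^in`. -/
def vIn {n k : ℕ} (D : Diagram n k) (b : ℕ × ℕ) : Equiv.Perm ℕ :=
  readProd D (fun c => decide (inIn b c))

/-- `u_b^D`: the label of `b` if `b` contains a stone, the identity if it contains a plus. -/
def uBox {n k : ℕ} (D : Diagram n k) (b : ℕ × ℕ) : Equiv.Perm ℕ :=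
  if D.fill b = Fill.plus then 1 else sbox n k b

/-- The length-drop condition `ℓ(u_{b^in} u_b s_b) < ℓ(u_{b^in} u_b)` at box `b`. -/
def lenDrop {n k : ℕ} (D : Diagram n k) (b : ℕ × ℕ) : Prop :=
  len n (uIn D b * uBox D b * sbox n k b) < len n (uIn D b * uBox D b)

/-- `b` violates the distinguished property: the length drops at `b`, but `b` is
not filled with a black stone. -/
def ViolatesDist {n k : ℕ} (D : Diagram n k) (b : ℕ × ℕ) : Prop :=
  b ∈ D.S.boxes ∧ D.fill b ≠ Fill.black ∧ lenDrop D b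

/-- `D` is a Go-diagram: a box contains a black stone iff the length drops there. -/
def IsGoDiagram {n k : ℕ} (D : Diagram n k) : Prop :=
  ∀ b ∈ D.S.boxes, (D.fill b = Fill.black ↔ lenDrop D b)

/-- Number of boxes of `D` with filling `f`. -/
def countFill {n k : ℕ} (D : Diagram n k) (f : Fill) : ℕ :=
  (D.S.boxes.filter (fun b => D.fill b = f)).card

/-- Length of row `r` of the shape. -/
def rowLen {n k : ℕ} (S : Shape n k) (r : ℕ) : ℕ :=
  ((Finset.range (n - k)).filter (fun c => (r, c) ∈ S.boxes)).card

/-- The (0-indexed) label of the vertical boundary step in row `r`. -/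
def vlab {n k : ℕ} (S : Shape n k) (r : ℕ) : ℕ := r + (n - k) - rowLen S r

/-- The (0-indexed) label of the horizontal boundary step in column `c`. -/
def hlab {n k : ℕ} (S : Shape n k) (c : ℕ) : ℕ :=
  (n - k - 1 - c) + ((Finset.range k).filter (fun r => c < rowLen S r)).card

/-- Labels of the pipes of the pipe dream of `D`: `pipeAux D fuel true b` is the
label of the pipe entering box `b` from the bottom, `pipeAux D fuel false b` the
label of the pipe entering from the right (stones are crossing tiles, pluses are
elbow tiles; pipes enter from the southeast boundary). -/
def pipeAux {n k : ℕ} (D : Diagram n k) : ℕ → Bool → ℕ × ℕ → ℕ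
  | 0, _, _ => 0
  | fuel + 1, true, b =>
      if (b.1 + 1, b.2) ∈ D.S.boxes then
        (if D.fill (b.1 + 1, b.2) = Fill.plus then pipeAux D fuel false (b.1 + 1, b.2)
          else pipeAux D fuel true (b.1 + 1, b.2))
      else hlab D.S b.2
  | fuel + 1, false, b =>
      if (b.1, b.2 + 1) ∈ D.S.boxes then
        (if D.fill (b.1, b.2 + 1) = Fill.plus then pipeAux D fuel true (b.1, b.2 + 1)
          else pipeAux D fuel false (b.1, b.2 + 1))
      else vlab D.S b.1

/-- The label of the pipe entering box `b` from the bottom. -/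
def pipeB {n k : ℕ} (D : Diagram n k) (b : ℕ × ℕ) : ℕ := pipeAux D (n + 1) true b

/-- The label of the pipe entering box `b` from the right. -/
def pipeR {n k : ℕ} (D : Diagram n k) (b : ℕ × ℕ) : ℕ := pipeAux D (n + 1) false b

/-- `b` is a box of `D` containing a stone (black or white). -/
def IsStone {n k : ℕ} (D : Diagram n k) (b : ℕ × ℕ) : Prop :=
  b ∈ D.S.boxes ∧ D.fill b ≠ Fill.plus

/-- The (unordered) pair of pipes passing through box `b`. -/
def pipePair {n k : ℕ} (D : Diagram n k) (b : ℕ × ℕ) : Finset ℕ :=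
  {pipeB D b, pipeR D b}

/-- `b, c` form a crossing/uncrossing pair: the same two pipes cross at `b`
(the pipe entering from the bottom is larger), flow northwest, and next
uncross at `c`. -/
def CrossUncrossPair {n k : ℕ} (D : Diagram n k) (b c : ℕ × ℕ) : Prop :=
  IsStone D b ∧ IsStone D c ∧ b ≠ c ∧
  pipeR D b < pipeB D b ∧ pipeB D c < pipeR D c ∧
  pipePair D b = pipePair D c ∧ inIn c b ∧
  ∀ d : ℕ × ℕ, IsStone D d → pipePair D d = pipePair D b →
    inIn c d → inIn d b → d = b ∨ d = c

/-- Stones of `D` are colored black iff they are uncrossing tiles. -/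
def BlackIffUncross {n k : ℕ} (D : Diagram n k) : Prop :=
  ∀ b ∈ D.S.boxes, (D.fill b = Fill.black ↔ (D.fill b ≠ Fill.plus ∧ pipeB D b < pipeR D b))

/-- Change the filling of box `b` to `f`. -/
def setFill {n k : ℕ} (D : Diagram n k) (b : ℕ × ℕ) (f : Fill) : Diagram n k :=
  ⟨D.S, fun c => if c = b then f else D.fill c⟩

/-- Recolor the stones of `D` so that a stone is black iff it is an uncrossing. -/
def recolor {n k : ℕ} (D : Diagram n k) : Diagram n k :=
  ⟨D.S, fun b => if D.fill b = Fill.plus then Fill.plus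
    else if pipeB D b < pipeR D b then Fill.black else Fill.white⟩

/-- Equality of diagrams: same shape and the same filling on every box of the shape. -/
def DEq {n k : ℕ} (D D' : Diagram n k) : Prop :=
  D.S = D'.S ∧ ∀ b ∈ D.S.boxes, D.fill b = D'.fill b

/-- The diagram obtained by switching the plus at `p` with the stone at `t`, then
recoloring stones black iff they are uncrossings. -/
def flipPlusWith {n k : ℕ} (D : Diagram n k) (p t : ℕ × ℕ) : Diagram n k :=
  recolor (setFill (setFill D p Fill.white) t Fill.plus)

/-- `(p, t)` is a legal corrective-flip pair for `D`: `p` is a plus violating the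
distinguished property, and `t` is either the white stone `w` with which it violates
the distinguished property (i.e. placing a crossing at `p` makes `(w, p)` a
crossing/uncrossing pair), or `w`'s uncrossing partner, if it exists. -/
def IsFlipPair {n k : ℕ} (D : Diagram n k) (p t : ℕ × ℕ) : Prop :=
  p ∈ D.S.boxes ∧ D.fill p = Fill.plus ∧ lenDrop D p ∧
  ∃ w : ℕ × ℕ, CrossUncrossPair (setFill D p Fill.white) w p ∧
    (t = w ∨ CrossUncrossPair D w t)

/-- `D'` is obtained from `D` by performing a corrective flip. -/
def IsCorrectiveFlip {n k : ℕ} (D D' : Diagram n k) : Prop :=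
  ∃ p t : ℕ × ℕ, IsFlipPair D p t ∧ DEq D' (flipPlusWith D p t)

/-- Product of the simple transpositions along a word. -/
def wordProd (w : List ℕ) : Equiv.Perm ℕ := (w.map sw).prod

/-- Bruhat order on `S_n`: `u ≤ v` iff some reduced word for `u` is a subword of
some reduced word for `v`. -/
def BruhatLE (n : ℕ) (u v : Equiv.Perm ℕ) : Prop :=
  ∃ wv : List ℕ, (∀ i ∈ wv, i + 1 < n) ∧ wordProd wv = v ∧ wv.length = len n v ∧
    ∃ wu : List ℕ, wu.Sublist wv ∧ wordProd wu = u ∧ wu.length = len n u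

/-- Componentwise order on finite subsets of `ℕ`. -/
def FinsetLE (S T : Finset ℕ) : Prop :=
  List.Forall₂ (· ≤ ·) (S.sort (· ≤ ·)) (T.sort (· ≤ ·))

/-- Strict componentwise order on finite subsets of `ℕ`. -/
def FinsetLT (S T : Finset ℕ) : Prop := FinsetLE S T ∧ S ≠ T

/-- The (0-indexed) top set `{n-k, …, n-1}` (the set `{n-k+1, …, n}` of the paper). -/
def topSet (n k : ℕ) : Finset ℕ := (Finset.range n).filter (fun i => n - k ≤ i)

/-- The set `I_b = u_{b^in} u_b (v_{b^in})⁻¹ v {n, n-1, …, n-k+1}`. -/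
def Iset {n k : ℕ} (D : Diagram n k) (b : ℕ × ℕ) : Finset ℕ :=
  (topSet n k).image (fun x => (uIn D b * uBox D b * (vIn D b)⁻¹ * permV D) x)

/-- The set `J_b = u_{b^in} (v_{b^in})⁻¹ v {n, n-1, …, n-k+1}`. -/
def Jset {n k : ℕ} (D : Diagram n k) (b : ℕ × ℕ) : Finset ℕ :=
  (topSet n k).image (fun x => (uIn D b * (vIn D b)⁻¹ * permV D) x)

/-- `I_λ`: the set of labels of the vertical boundary steps of the shape. -/
def Ilam {n k : ℕ} (S : Shape n k) : Finset ℕ := (Finset.range k).image (fun r => vlab S r)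

/-- The Plücker coordinate of a `k × n` matrix at a `k`-subset `I ⊆ {0,…,n-1}`. -/
noncomputable def plucker {n k : ℕ} (A : Matrix (Fin k) (Fin n) ℝ) (I : Finset ℕ) : ℝ :=
  Matrix.det (Matrix.of fun i j : Fin k =>
    if h : (I.sort (· ≤ ·)).getD (j : ℕ) 0 < n then A i ⟨(I.sort (· ≤ ·)).getD (j : ℕ) 0, h⟩
    else 0)

/-- Full-rank `k × n` real matrices: representatives of points of `Gr(k,n)`. -/
def GrRep (k n : ℕ) : Type := {A : Matrix (Fin k) (Fin n) ℝ // A.rank = k}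

instance (k n : ℕ) : TopologicalSpace (GrRep k n) := by unfold GrRep; infer_instance

/-- Row equivalence of full-rank matrices. -/
def grSetoid (k n : ℕ) : Setoid (GrRep k n) where
  r A B := ∃ g : Matrix (Fin k) (Fin k) ℝ, IsUnit g.det ∧ B.1 = g * A.1
  iseqv := by
    refine ⟨fun A => ⟨1, ?_, ?_⟩, ?_, ?_⟩
    · simp
    · simp
    · rintro A B ⟨g, hg, hB⟩
      refine ⟨g⁻¹, Matrix.isUnit_nonsing_inv_det g hg, ?_⟩
      rw [hB, ← Matrix.mul_assoc, Matrix.nonsing_inv_mul g hg, Matrix.one_mul]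
    · rintro A B C ⟨g, hg, hB⟩ ⟨h, hh, hC⟩
      exact ⟨h * g, by rw [Matrix.det_mul]; exact hh.mul hg,
        by rw [hC, hB, Matrix.mul_assoc]⟩

/-- The Grassmannian `Gr(k,n)`, as the quotient of full-rank `k × n` matrices by
row equivalence, with the quotient topology. -/
def Gr (k n : ℕ) : Type := Quotient (grSetoid k n)

instance (k n : ℕ) : TopologicalSpace (Gr k n) := by
  unfold Gr; exact instTopologicalSpaceQuotient

/-- Matrix representatives of the Deodhar component indexed by a Go-diagram `D`:
`Δ_{I_b} = 0` for white-stone boxes, `Δ_{I_b} ≠ 0` for plus boxes, `Δ_{I_λ} ≠ 0`,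
and `Δ_S = 0` whenever `S ≱ I_λ`. -/
def deodharRep {n k : ℕ} (D : Diagram n k) : Set (Matrix (Fin k) (Fin n) ℝ) :=
  {A | (∀ b ∈ D.S.boxes, D.fill b = Fill.white → plucker A (Iset D b) = 0) ∧
      (∀ b ∈ D.S.boxes, D.fill b = Fill.plus → plucker A (Iset D b) ≠ 0) ∧
      plucker A (Ilam D.S) ≠ 0 ∧
      (∀ S : Finset ℕ, S ⊆ Finset.range n → S.card = k →
        ¬ FinsetLE (Ilam D.S) S → plucker A S = 0)}

/-- The Deodhar component in `Gr(k,n)` indexed by a Go-diagram `D`. -/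
def deodhar {n k : ℕ} (D : Diagram n k) : Set (Gr k n) :=
  {x | ∃ A : GrRep k n, Quotient.mk (grSetoid k n) A = x ∧ A.1 ∈ deodharRep D}

/-- The dimension of the Deodhar component indexed by `D` (by Deodhar's theorem,
the component is homeomorphic to `ℝ^{#black} × (ℝ \ {0})^{#plus}`). -/
def dimD {n k : ℕ} (D : Diagram n k) : ℕ :=
  countFill D Fill.black + countFill D Fill.plus

/-- The positroid cell of shape `S` and permutation `u`: the union of the Deodhar
components indexed by Go-diagrams of shape `S` with pipe-dream permutation `u`. -/
def positroid {n k : ℕ} (S : Shape n k) (u : Equiv.Perm ℕ) : Set (Gr k n) :=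
  {x | ∃ D : Diagram n k, D.S = S ∧ IsGoDiagram D ∧ permU D = u ∧ x ∈ deodhar D}

/-- A Le-diagram: no black stones, and no white stone with a plus above it in its
column and a plus to its left in its row. -/
def IsLeDiagram {n k : ℕ} (D : Diagram n k) : Prop :=
  (∀ b ∈ D.S.boxes, D.fill b ≠ Fill.black) ∧
  ∀ b ∈ D.S.boxes, D.fill b = Fill.white →
    ¬((∃ r : ℕ, r < b.1 ∧ D.fill (r, b.2) = Fill.plus) ∧
      (∃ c : ℕ, c < b.2 ∧ D.fill (b.1, c) = Fill.plus))

/-- A Le-move: on a rectangle with pluses in the top-left, top-right and bottom-left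
corners, a white stone in the bottom-right corner, and white stones elsewhere,
exchange the top-left plus with the bottom-right white stone. -/
def IsLeMove {n k : ℕ} (D D' : Diagram n k) : Prop :=
  D'.S = D.S ∧
  ∃ r1 r2 c1 c2 : ℕ, r1 < r2 ∧ c1 < c2 ∧ (r2, c2) ∈ D.S.boxes ∧
    D.fill (r1, c1) = Fill.plus ∧ D.fill (r1, c2) = Fill.plus ∧
    D.fill (r2, c1) = Fill.plus ∧ D.fill (r2, c2) = Fill.white ∧
    (∀ r c : ℕ, r1 ≤ r → r ≤ r2 → c1 ≤ c → c ≤ c2 →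
      ¬((r = r1 ∨ r = r2) ∧ (c = c1 ∨ c = c2)) → D.fill (r, c) = Fill.white) ∧
    D'.fill (r1, c1) = Fill.white ∧ D'.fill (r2, c2) = Fill.plus ∧
    (∀ b : ℕ × ℕ, b ≠ (r1, c1) → b ≠ (r2, c2) → D'.fill b = D.fill b)

/-- The first black stone or plus strictly to the right of `b` in its row. -/
def firstRight {n k : ℕ} (D : Diagram n k) (b : ℕ × ℕ) : Option (ℕ × ℕ) :=
  ((List.range (n - k)).map fun t => (b.1, b.2 + 1 + t)).find?
    (fun x => decide (x ∈ D.S.boxes ∧ D.fill x ≠ Fill.white))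

/-- The first black stone or plus strictly below `b` in its column. -/
def firstDown {n k : ℕ} (D : Diagram n k) (b : ℕ × ℕ) : Option (ℕ × ℕ) :=
  ((List.range k).map fun t => (b.1 + 1 + t, b.2)).find?
    (fun x => decide (x ∈ D.S.boxes ∧ D.fill x ≠ Fill.white))

/-- `x` is (relative to the oracle `pf`) the partner of some black stone of `b^in`
other than `b`. -/
noncomputable def partneredWhite {n k : ℕ} (D : Diagram n k) (pf : ℕ × ℕ → Option (ℕ × ℕ))
    (b x : ℕ × ℕ) : Bool :=
  D.S.boxes.toList.any fun d =>
    decide (inIn b d ∧ d ≠ b ∧ D.fill d = Fill.black ∧ pf d = some x)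

/-- Step 5 of the partner algorithm: the path from `b` travelling right
(`dir = true`) or down (`dir = false`), given an oracle `pf` of previously
assigned partners; turns at pluses, jumps at black stones to their partners,
and turns at white stones partnered with black stones of `b^in`. -/
noncomputable def pathAux {n k : ℕ} (D : Diagram n k) (pf : ℕ × ℕ → Option (ℕ × ℕ)) (b : ℕ × ℕ) :
    ℕ → Bool → ℕ × ℕ → List (ℕ × ℕ)
  | 0, _, _ => []
  | fuel + 1, dir, x =>
      let x' : ℕ × ℕ := if dir then (x.1, x.2 + 1) else (x.1 + 1, x.2)
      if x' ∈ D.S.boxes then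
        match D.fill x' with
        | Fill.plus => x' :: pathAux D pf b fuel (!dir) x'
        | Fill.black =>
            match pf x' with
            | some q => x' :: q :: pathAux D pf b fuel (!dir) q
            | none => [x']
        | Fill.white =>
            if partneredWhite D pf b x' then x' :: pathAux D pf b fuel (!dir) x'
            else x' :: pathAux D pf b fuel dir x'
      else []

/-- One step of the partner algorithm at box `b`, given an oracle `pf` of
previously assigned partners. Returns (partner of `b`, path `P_b`, path `Q_b`). -/
noncomputable def partnerCore {n k : ℕ} (D : Diagram n k) (pf : ℕ × ℕ → Option (ℕ × ℕ)) (b : ℕ × ℕ) :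
    Option (ℕ × ℕ) × List (ℕ × ℕ) × List (ℕ × ℕ) :=
  match firstRight D b, firstDown D b with
  | some c, some d =>
      let e : ℕ × ℕ := (d.1, c.2)
      if e ∈ D.S.boxes ∧
          (¬ ∃ i ∈ Finset.range d.1, b.1 < i ∧ (i, c.2) ∈ D.S.boxes ∧
            D.fill (i, c.2) ≠ Fill.white) ∧
          (¬ ∃ j ∈ Finset.range c.2, b.2 < j ∧ (d.1, j) ∈ D.S.boxes ∧
            D.fill (d.1, j) ≠ Fill.white) then
        if D.fill e = Fill.white then
          (some e,
            b :: (((List.range (c.2 - b.2)).map fun t => (b.1, b.2 + 1 + t)) ++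
              ((List.range (d.1 - b.1)).map fun t => (b.1 + 1 + t, c.2))),
            b :: (((List.range (d.1 - b.1)).map fun t => (b.1 + 1 + t, b.2)) ++
              ((List.range (c.2 - b.2)).map fun t => (d.1, b.2 + 1 + t))))
        else
          let P := b :: pathAux D pf b (n + 1) true b
          let Q := b :: pathAux D pf b (n + 1) false b
          let common := P.filter (fun m => decide (m ∈ Q))
          match common.find? (fun m => common.all fun m' => decide (inIn m m')) with
          | some m => (if D.fill m = Fill.white then some m else none, P, Q)
          | none => (none, P, Q)
      else (none, [], [])
  | _, _ => (none, [], [])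

/-- Iterated partner assignment (the recursion bottoms out along the partial
order `≼`, whose chains have length at most `n`). -/
noncomputable def partnerAux {n k : ℕ} (D : Diagram n k) : ℕ → ℕ × ℕ → Option (ℕ × ℕ)
  | 0, _ => none
  | m + 1, b => (partnerCore D (partnerAux D m) b).1

/-- The partner of box `b` in `D` (if any), per the recursive partner algorithm. -/
noncomputable def partner {n k : ℕ} (D : Diagram n k) (b : ℕ × ℕ) : Option (ℕ × ℕ) :=
  partnerAux D (n + 2) b

/-- The path `P_b` of the partner algorithm. -/
noncomputable def pathP {n k : ℕ} (D : Diagram n k) (b : ℕ × ℕ) : List (ℕ × ℕ) :=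
  (partnerCore D (partnerAux D (n + 1)) b).2.1

/-- The path `Q_b` of the partner algorithm. -/
noncomputable def pathQ {n k : ℕ} (D : Diagram n k) (b : ℕ × ℕ) : List (ℕ × ℕ) :=
  (partnerCore D (partnerAux D (n + 1)) b).2.2

/-- `f(D,b)`: replace with pluses all black stones in boxes `c ≺ b` and all white
stones that are partners of such boxes. -/
noncomputable def fDb {n k : ℕ} (D : Diagram n k) (b : ℕ × ℕ) : Diagram n k :=
  ⟨D.S, fun x =>
    if (D.fill x = Fill.black ∧ inIn b x ∧ x ≠ b) ∨
        (∃ c ∈ D.S.boxes, inIn b c ∧ c ≠ b ∧ D.fill c = Fill.black ∧ partner D c = some x)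
    then Fill.plus else D.fill x⟩

/-- Replace all black stones of `D`, and all of their partners, with pluses. -/
noncomputable def reduceGo {n k : ℕ} (D : Diagram n k) : Diagram n k :=
  ⟨D.S, fun x =>
    if D.fill x = Fill.black ∨
        (∃ c ∈ D.S.boxes, D.fill c = Fill.black ∧ partner D c = some x)
    then Fill.plus else D.fill x⟩

/-- Product, in a reading order, of the labels of the stone boxes of `b^in`. -/
def stonesProd {n k : ℕ} (D : Diagram n k) (b : ℕ × ℕ) : Equiv.Perm ℕ :=
  readProd D (fun c => decide (inIn b c ∧ D.fill c ≠ Fill.plus))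

/-- Property (P1) at `b`: the product of the labels of the stone boxes of `b^in`
is the same in `f(D,b)` as in `D`. -/
def P1 {n k : ℕ} (D : Diagram n k) (b : ℕ × ℕ) : Prop :=
  stonesProd (fDb D b) b = stonesProd D b

/-- Property (P2) at `b`: `b` has partner `p` iff `p` and `b` form a
crossing/uncrossing pair in the pipe dream of `f(D,b)`. -/
def P2 {n k : ℕ} (D : Diagram n k) (b : ℕ × ℕ) : Prop :=
  ∀ p : ℕ × ℕ, (partner D b = some p ↔ CrossUncrossPair (fDb D b) p b)

/-- `D` is a (nonempty) full `rows × cols` rectangle. -/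
def IsRectangle {n k : ℕ} (D : Diagram n k) (rows cols : ℕ) : Prop :=
  0 < rows ∧ 0 < cols ∧ D.S.boxes = Finset.range rows ×ˢ Finset.range cols

/-- A minimal violation: a rectangular diagram in which the only box violating the
distinguished property is the top-left corner, and the pair of pipes that should
uncross there initially cross in the bottom-right corner. -/
def IsMinimalViolation {n k : ℕ} (D : Diagram n k) (rows cols : ℕ) : Prop :=
  IsRectangle D rows cols ∧
  ViolatesDist D (0, 0) ∧
  (∀ b ∈ D.S.boxes, ViolatesDist D b → b = (0, 0)) ∧
  pipePair D (0, 0) = pipePair D (rows - 1, cols - 1) ∧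
  D.fill (rows - 1, cols - 1) ≠ Fill.plus ∧
  pipeR D (rows - 1, cols - 1) < pipeB D (rows - 1, cols - 1)


/-- The position reached by moving one step down (`x = true`) or right (`x = false`). -/
def downOrRight (x : Bool) (b : ℕ × ℕ) : ℕ × ℕ :=
  if x then (b.1 + 1, b.2) else (b.1, b.2 + 1)

/-- One step to the southeast along the pipe which enters a box from the bottom
(`e.1 = true`) or from the right (`e.1 = false`); outside of the shape pipes go straight. -/
def pipeStep {n k : ℕ} (D : Diagram n k) (e : Bool × (ℕ × ℕ)) : Bool × (ℕ × ℕ) :=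
  (xor e.1 (decide (downOrRight e.1 e.2 ∈ D.S.boxes ∧ D.fill (downOrRight e.1 e.2) = Fill.plus)),
    downOrRight e.1 e.2)

/-- The label of the pipe entering a box from the bottom or from the right. -/
def pipeLabel {n k : ℕ} (D : Diagram n k) (e : Bool × (ℕ × ℕ)) : ℕ := pipeAux D (n + 1) e.1 e.2

lemma Shape.add_lt {n k : ℕ} (S : Shape n k) {b : ℕ × ℕ} (hb : b ∈ S.boxes) :
    b.1 + b.2 + 2 ≤ n := by
  have h1 := S.row_lt b hb
  have h2 := S.col_lt b hb
  omega

lemma downOrRight_add (x : Bool) (b : ℕ × ℕ) :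
    (downOrRight x b).1 + (downOrRight x b).2 = b.1 + b.2 + 1 := by
  cases x <;> simp [downOrRight] <;> omega

lemma inIn_downOrRight (x : Bool) (b : ℕ × ℕ) : inIn b (downOrRight x b) := by
  cases x <;> simp [downOrRight, inIn]

lemma inIn_trans {a b c : ℕ × ℕ} (h : inIn a b) (h' : inIn b c) : inIn a c :=
  ⟨h.1.trans h'.1, h.2.trans h'.2⟩

lemma inIn_add_lt {a b : ℕ × ℕ} (h : inIn a b) (hne : a ≠ b) : a.1 + a.2 < b.1 + b.2 := by
  obtain ⟨h1, h2⟩ := h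
  rcases Nat.lt_or_ge (a.1 + a.2) (b.1 + b.2) with h | h
  · exact h
  · exact absurd (Prod.ext (by omega) (by omega)) hne

lemma lt_card_filter_range_iff {N : ℕ} {P : ℕ → Prop} [DecidablePred P]
    (hP : ∀ m m', m ≤ m' → m' < N → P m' → P m) {c : ℕ} (hc : c < N) :
    c < ((Finset.range N).filter P).card ↔ P c := by
  constructor
  · intro h
    by_contra hcon
    have hsub : (Finset.range N).filter P ⊆ Finset.range c := by
      intro m hm
      simp only [Finset.mem_filter, Finset.mem_range] at hm ⊢
      by_contra hmc
      exact hcon (hP c m (by omega) hm.1 hm.2)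
    have := Finset.card_le_card hsub
    simp at this
    omega
  · intro h
    have hsub : Finset.range (c + 1) ⊆ (Finset.range N).filter P := by
      intro m hm
      simp only [Finset.mem_filter, Finset.mem_range] at hm ⊢
      exact ⟨by omega, hP m c (by omega) hc h⟩
    have := Finset.card_le_card hsub
    simp at this
    omega

lemma lt_rowLen_iff {n k : ℕ} (S : Shape n k) (r : ℕ) {c : ℕ} (hc : c < n - k) :
    c < rowLen S r ↔ (r, c) ∈ S.boxes :=
  lt_card_filter_range_iff (P := fun c => (r, c) ∈ S.boxes)
    (fun m _ h _ h' => S.nw_closed _ h' r m le_rfl h) hc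

lemma rowLen_le {n k : ℕ} (S : Shape n k) (r : ℕ) : rowLen S r ≤ n - k :=
  (Finset.card_filter_le _ _).trans (by simp)

lemma rowLen_anti {n k : ℕ} (S : Shape n k) {r r' : ℕ} (h : r ≤ r') :
    rowLen S r' ≤ rowLen S r := by
  apply Finset.card_le_card
  intro c hc
  simp only [Finset.mem_filter] at hc ⊢
  exact ⟨hc.1, S.nw_closed _ hc.2 r c h le_rfl⟩

lemma vlab_strictMono {n k : ℕ} (S : Shape n k) : StrictMono (vlab S) := by
  intro r r' h
  have h1 := rowLen_anti S h.le
  have h2 := rowLen_le S r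
  have h3 := rowLen_le S r'
  unfold vlab
  omega

lemma hlab_lt_hlab {n k : ℕ} (S : Shape n k) {c c' : ℕ} (h : c < c') (hc' : c' < n - k) :
    hlab S c' < hlab S c := by
  have : ((Finset.range k).filter (fun r => c' < rowLen S r)).card ≤
      ((Finset.range k).filter (fun r => c < rowLen S r)).card := by
    apply Finset.card_le_card
    intro r hr
    simp only [Finset.mem_filter] at hr ⊢
    exact ⟨hr.1, h.trans hr.2⟩
  unfold hlab
  omega

lemma hlab_inj {n k : ℕ} (S : Shape n k) {c c' : ℕ} (hc : c < n - k) (hc' : c' < n - k)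
    (h : hlab S c = hlab S c') : c = c' := by
  rcases lt_trichotomy c c' with h1 | h1 | h1
  · have := hlab_lt_hlab S h1 hc'
    omega
  · exact h1
  · have := hlab_lt_hlab S h1 hc
    omega

lemma hlab_ne_vlab {n k : ℕ} (S : Shape n k) {r c : ℕ} (hc : c < n - k) (hr : r < k) :
    hlab S c ≠ vlab S r := by
  have h1 := lt_card_filter_range_iff (N := k) (P := fun r => c < rowLen S r)
    (fun _ _ h _ h' => lt_of_lt_of_le h' (rowLen_anti S h)) hr
  have h2 := rowLen_le S r
  unfold hlab vlab
  by_cases h : c < rowLen S r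
  · have := h1.2 h
    omega
  · have := mt h1.1 h
    omega

lemma pipeAux_succ {n k : ℕ} (D : Diagram n k) (f : ℕ) (x : Bool) (b : ℕ × ℕ) :
    pipeAux D (f + 1) x b =
      if downOrRight x b ∈ D.S.boxes then
        pipeAux D f (pipeStep D (x, b)).1 (pipeStep D (x, b)).2
      else if x then hlab D.S b.2 else vlab D.S b.1 := by
  cases x
  · by_cases h : (b.1, b.2 + 1) ∈ D.S.boxes <;>
      by_cases h' : D.fill (b.1, b.2 + 1) = Fill.plus <;>
      simp [pipeAux, pipeStep, downOrRight, h, h']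
  · by_cases h : (b.1 + 1, b.2) ∈ D.S.boxes <;>
      by_cases h' : D.fill (b.1 + 1, b.2) = Fill.plus <;>
      simp [pipeAux, pipeStep, downOrRight, h, h']

lemma pipeAux_stable {n k : ℕ} (D : Diagram n k) (f : ℕ) :
    ∀ (x : Bool) (b : ℕ × ℕ), n ≤ f + 1 + b.1 + b.2 →
      pipeAux D (f + 2) x b = pipeAux D (f + 1) x b := by
  induction f with
  | zero =>
    intro x b h
    have hb : downOrRight x b ∉ D.S.boxes := fun hb => by
      have := D.S.add_lt hb
      have := downOrRight_add x b
      omega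
    rw [pipeAux_succ D 1 x b, pipeAux_succ D 0 x b, if_neg hb, if_neg hb]
  | succ f ih =>
    intro x b h
    rw [pipeAux_succ D (f + 2) x b, pipeAux_succ D (f + 1) x b]
    have := downOrRight_add x b
    rw [ih _ _ (by simp only [pipeStep]; omega)]

lemma pipeLabel_of_notMem {n k : ℕ} (D : Diagram n k) {e : Bool × (ℕ × ℕ)}
    (h : downOrRight e.1 e.2 ∉ D.S.boxes) :
    pipeLabel D e = if e.1 then hlab D.S e.2.2 else vlab D.S e.2.1 := by
  rw [pipeLabel, pipeAux_succ, if_neg h]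

lemma Shape.downOrRight_notMem {n k : ℕ} (S : Shape n k) {x : Bool} {b : ℕ × ℕ}
    (h : downOrRight x b ∉ S.boxes) : downOrRight x (downOrRight x b) ∉ S.boxes :=
  fun h' => h (S.nw_closed _ h' _ _ (inIn_downOrRight _ _).1 (inIn_downOrRight _ _).2)

lemma pipeLabel_pipeStep {n k : ℕ} (D : Diagram n k) (e : Bool × (ℕ × ℕ)) :
    pipeLabel D (pipeStep D e) = pipeLabel D e := by
  obtain ⟨x, b⟩ := e
  by_cases h : downOrRight x b ∈ D.S.boxes
  · have hn := D.S.add_lt h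
    obtain ⟨m, rfl⟩ : ∃ m, n = m + 1 := ⟨n - 1, by omega⟩
    rw [pipeLabel, pipeLabel, pipeAux_succ D (m + 1) x b, if_pos h]
    exact pipeAux_stable D m _ _ (by omega)
  · have hs : pipeStep D (x, b) = (x, downOrRight x b) := by simp [pipeStep, h]
    rw [hs, pipeLabel_of_notMem D (D.S.downOrRight_notMem h), pipeLabel_of_notMem D h]
    cases x <;> simp [downOrRight]

lemma pipeLabel_iterate {n k : ℕ} (D : Diagram n k) (m : ℕ) (e : Bool × (ℕ × ℕ)) :
    pipeLabel D ((pipeStep D)^[m] e) = pipeLabel D e := by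
  induction m with
  | zero => rfl
  | succ m ih => rw [Function.iterate_succ_apply', pipeLabel_pipeStep, ih]

lemma pipeStep_injective {n k : ℕ} (D : Diagram n k) : Function.Injective (pipeStep D) := by
  rintro ⟨x, b⟩ ⟨y, c⟩ h
  simp only [pipeStep, Prod.mk.injEq] at h
  obtain ⟨h1, h2⟩ := h
  rw [h2] at h1
  have hxy : x = y := by
    revert h1
    generalize decide (downOrRight y c ∈ D.S.boxes ∧ D.fill (downOrRight y c) = Fill.plus) = v
    cases x <;> cases y <;> cases v <;> simp
  subst hxy
  cases x <;> simp only [downOrRight, Prod.mk.injEq, if_true, if_false, Bool.false_eq_true] at h2 <;>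
    exact Prod.ext rfl (Prod.ext (by simp only; omega) (by simp only; omega))

lemma iterate_pipeStep_add {n k : ℕ} (D : Diagram n k) (m : ℕ) (e : Bool × (ℕ × ℕ)) :
    ((pipeStep D)^[m] e).2.1 + ((pipeStep D)^[m] e).2.2 = e.2.1 + e.2.2 + m := by
  induction m with
  | zero => rfl
  | succ m ih =>
    rw [Function.iterate_succ_apply']
    have := downOrRight_add ((pipeStep D)^[m] e).1 ((pipeStep D)^[m] e).2
    simp only [pipeStep] at this ih ⊢
    omega

lemma inIn_iterate_pipeStep {n k : ℕ} (D : Diagram n k) (m : ℕ) (e : Bool × (ℕ × ℕ)) :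
    inIn e.2 ((pipeStep D)^[m] e).2 := by
  induction m with
  | zero => exact ⟨le_rfl, le_rfl⟩
  | succ m ih =>
    rw [Function.iterate_succ_apply']
    exact inIn_trans ih (inIn_downOrRight _ _)

lemma iterate_pipeStep_bounds {n k : ℕ} (D : Diagram n k) {e : Bool × (ℕ × ℕ)}
    (he : e.2 ∈ D.S.boxes) (m : ℕ) :
    (((pipeStep D)^[m] e).1 = true → ((pipeStep D)^[m] e).2.2 < n - k) ∧
      (((pipeStep D)^[m] e).1 = false → ((pipeStep D)^[m] e).2.1 < k) := by
  induction m with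
  | zero => exact ⟨fun _ => D.S.col_lt _ he, fun _ => D.S.row_lt _ he⟩
  | succ m ih =>
    rw [Function.iterate_succ_apply']
    generalize (pipeStep D)^[m] e = g at ih
    obtain ⟨x, b⟩ := g
    by_cases h : downOrRight x b ∈ D.S.boxes
    · exact ⟨fun _ => D.S.col_lt _ h, fun _ => D.S.row_lt _ h⟩
    · have hs : pipeStep D (x, b) = (x, downOrRight x b) := by simp [pipeStep, h]
      rw [hs]
      cases x <;> simpa [downOrRight] using ih

/-- Two edges of the pipe dream with the same label lie on a common pipe. -/
lemma iterate_pipeStep_of_pipeLabel_eq {n k : ℕ} (D : Diagram n k) {e f : Bool × (ℕ × ℕ)}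
    (he : e.2 ∈ D.S.boxes) (hf : f.2 ∈ D.S.boxes) (hL : pipeLabel D e = pipeLabel D f)
    (hle : e.2.1 + e.2.2 ≤ f.2.1 + f.2.2) :
    (pipeStep D)^[f.2.1 + f.2.2 - (e.2.1 + e.2.2)] e = f := by
  apply (pipeStep_injective D).iterate n
  rw [← Function.iterate_add_apply]
  set m := f.2.1 + f.2.2 - (e.2.1 + e.2.2) with hm
  have h1 := iterate_pipeStep_add D (n + m) e
  have h2 := iterate_pipeStep_add D n f
  have h3 := iterate_pipeStep_bounds D he (n + m)
  have h4 := iterate_pipeStep_bounds D hf n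
  rw [← pipeLabel_iterate D (n + m) e, ← pipeLabel_iterate D n f] at hL
  generalize (pipeStep D)^[n + m] e = g at *
  generalize (pipeStep D)^[n] f = g' at *
  have out : ∀ g : Bool × (ℕ × ℕ), n ≤ g.2.1 + g.2.2 → downOrRight g.1 g.2 ∉ D.S.boxes := by
    intro g hg hb
    have := D.S.add_lt hb
    have := downOrRight_add g.1 g.2
    omega
  rw [pipeLabel_of_notMem D (out g (by omega)), pipeLabel_of_notMem D (out g' (by omega))] at hL
  obtain ⟨x, r, c⟩ := g
  obtain ⟨y, r', c'⟩ := g'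
  simp only at *
  cases x <;> cases y <;> simp at hL h3 h4
  · have := (vlab_strictMono D.S).injective hL
    simp only [Prod.mk.injEq, true_and]
    omega
  · exact absurd hL.symm (hlab_ne_vlab D.S h4 h3)
  · exact absurd hL (hlab_ne_vlab D.S h3 h4)
  · have := hlab_inj D.S h3 h4 hL
    simp only [Prod.mk.injEq, true_and]
    omega

lemma inIn_of_pipeLabel_eq {n k : ℕ} (D : Diagram n k) {e f : Bool × (ℕ × ℕ)}
    (he : e.2 ∈ D.S.boxes) (hf : f.2 ∈ D.S.boxes) (hL : pipeLabel D e = pipeLabel D f)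
    (hle : e.2.1 + e.2.2 ≤ f.2.1 + f.2.2) : inIn e.2 f.2 := by
  have h := inIn_iterate_pipeStep D (f.2.1 + f.2.2 - (e.2.1 + e.2.2)) e
  rwa [iterate_pipeStep_of_pipeLabel_eq D he hf hL hle] at h

lemma inIn_downOrRight_of_pipeLabel_eq {n k : ℕ} (D : Diagram n k) {e f : Bool × (ℕ × ℕ)}
    (he : e.2 ∈ D.S.boxes) (hf : f.2 ∈ D.S.boxes) (hL : pipeLabel D e = pipeLabel D f)
    (hlt : e.2.1 + e.2.2 < f.2.1 + f.2.2) : inIn (downOrRight e.1 e.2) f.2 := by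
  have h := iterate_pipeStep_of_pipeLabel_eq D he hf hL hlt.le
  obtain ⟨m, hm⟩ : ∃ m, f.2.1 + f.2.2 - (e.2.1 + e.2.2) = m + 1 :=
    ⟨f.2.1 + f.2.2 - (e.2.1 + e.2.2) - 1, by omega⟩
  rw [hm, Function.iterate_succ_apply] at h
  have h' := inIn_iterate_pipeStep D m (pipeStep D e)
  rwa [h] at h'

lemma pipeLabel_eq_ite {n k : ℕ} (D : Diagram n k) (x : Bool) (b : ℕ × ℕ) :
    pipeLabel D (x, b) = if x then pipeB D b else pipeR D b := by
  cases x <;> rfl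

lemma pipeLabel_congr {n k : ℕ} (D E : Diagram n k) (hS : E.S = D.S) (s : ℕ)
    (hfill : ∀ c : ℕ × ℕ, s < c.1 + c.2 → (E.fill c = Fill.plus ↔ D.fill c = Fill.plus)) :
    ∀ e : Bool × (ℕ × ℕ), s ≤ e.2.1 + e.2.2 → pipeLabel E e = pipeLabel D e := by
  have key : ∀ (m : ℕ) (e : Bool × (ℕ × ℕ)), s ≤ e.2.1 + e.2.2 → n ≤ e.2.1 + e.2.2 + m →
      pipeLabel E e = pipeLabel D e := by
    intro m
    induction m with
    | zero =>
      intro e _ hn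
      have h : downOrRight e.1 e.2 ∉ D.S.boxes := fun h => by
        have := D.S.add_lt h
        have := downOrRight_add e.1 e.2
        omega
      rw [pipeLabel_of_notMem D h, pipeLabel_of_notMem E (hS ▸ h), hS]
    | succ m ih =>
      intro e hs hn
      have hd := downOrRight_add e.1 e.2
      have hstep : pipeStep E e = pipeStep D e := by
        simp only [pipeStep, hS, hfill _ (show s < (downOrRight e.1 e.2).1 + _ by omega)]
      rw [← pipeLabel_pipeStep E, ← pipeLabel_pipeStep D, hstep]
      exact ih _ (by simp only [pipeStep]; omega) (by simp only [pipeStep]; omega)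
  exact fun e hs => key n e hs (by omega)

lemma pipePair_congr {n k : ℕ} (D E : Diagram n k) (hS : E.S = D.S) (b : ℕ × ℕ)
    (hfill : ∀ c : ℕ × ℕ, b.1 + b.2 < c.1 + c.2 → (E.fill c = Fill.plus ↔ D.fill c = Fill.plus)) :
    pipePair E b = pipePair D b := by
  have h := pipeLabel_congr D E hS _ hfill
  have h1 : pipeB E b = pipeB D b := h (true, b) le_rfl
  have h2 : pipeR E b = pipeR D b := h (false, b) le_rfl
  rw [pipePair, pipePair, h1, h2]

lemma mem_pipePair_iff {n k : ℕ} (D : Diagram n k) (b : ℕ × ℕ) (l : ℕ) :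
    l ∈ pipePair D b ↔ ∃ x, pipeLabel D (x, b) = l := by
  simp [pipePair, pipeLabel_eq_ite, eq_comm, or_comm]

/-- Switching the tiles at two boxes `a`, `z` through which the same two pipes pass
exchanges the labels of these pipes in the rectangle spanned by `a` and `z`, and changes
no other labels. -/
lemma pipeLabel_of_switch {n k : ℕ} (D E : Diagram n k) (hS : E.S = D.S) {a z : ℕ × ℕ}
    (ha : a ∈ D.S.boxes) (hza : inIn z a) (hne : z ≠ a)
    (hpair : pipePair D z = pipePair D a)
    (hfa : E.fill a = Fill.plus ↔ ¬ D.fill a = Fill.plus)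
    (hfz : E.fill z = Fill.plus ↔ ¬ D.fill z = Fill.plus)
    (hfill : ∀ c : ℕ × ℕ, c ≠ a → c ≠ z → (E.fill c = Fill.plus ↔ D.fill c = Fill.plus)) :
    ∀ (x : Bool) (b : ℕ × ℕ), b ∈ D.S.boxes → pipeLabel E (x, b) =
      if inIn z b ∧ inIn b a ∧ b ≠ a then
        Equiv.swap (pipeB D a) (pipeR D a) (pipeLabel D (x, b))
      else pipeLabel D (x, b) := by
  have hz : z ∈ D.S.boxes := D.S.nw_closed a ha _ _ hza.1 hza.2
  have hlt := inIn_add_lt hza hne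
  have swap_of_notMem : ∀ l, l ∉ pipePair D a → Equiv.swap (pipeB D a) (pipeR D a) l = l := by
    intro l hl
    simp only [pipePair, Finset.mem_insert, Finset.mem_singleton, not_or] at hl
    exact Equiv.swap_apply_of_ne_of_ne hl.1 hl.2
  have swap_a : ∀ x, Equiv.swap (pipeB D a) (pipeR D a) (pipeLabel D (x, a)) =
      pipeLabel D (!x, a) := by
    intro x
    cases x <;> simp [pipeLabel_eq_ite]
  have swap_z : ∀ x, Equiv.swap (pipeB D a) (pipeR D a) (pipeLabel D (x, z)) =
      pipeLabel D (!x, z) := by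
    have h1 : pipeB D z ∈ pipePair D a := by rw [← hpair]; simp [pipePair]
    have h2 : pipeR D z ∈ pipePair D a := by rw [← hpair]; simp [pipePair]
    have h3 : pipeB D a ∈ pipePair D z := by rw [hpair]; simp [pipePair]
    have h4 : pipeR D a ∈ pipePair D z := by rw [hpair]; simp [pipePair]
    simp only [pipePair, Finset.mem_insert, Finset.mem_singleton] at h1 h2 h3 h4
    intro x
    cases x <;> simp only [pipeLabel_eq_ite, Equiv.swap_apply_def] <;> grind
  -- an edge carrying one of the two pipes, before `a`, stays northwest of `a` after one step
  have below_a : ∀ e : Bool × (ℕ × ℕ), e.2 ∈ D.S.boxes → pipeLabel D e ∈ pipePair D a →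
      e.2.1 + e.2.2 < a.1 + a.2 → inIn (downOrRight e.1 e.2) a := by
    intro e he hl hs
    obtain ⟨y, hy⟩ := (mem_pipePair_iff D a _).1 hl
    exact inIn_downOrRight_of_pipeLabel_eq D (f := (y, a)) he ha hy.symm hs
  have above_z : ∀ e : Bool × (ℕ × ℕ), e.2 ∈ D.S.boxes → pipeLabel D e ∈ pipePair D a →
      z.1 + z.2 ≤ e.2.1 + e.2.2 → inIn z e.2 := by
    intro e he hl hs
    rw [← hpair] at hl
    obtain ⟨y, hy⟩ := (mem_pipePair_iff D z _).1 hl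
    exact inIn_of_pipeLabel_eq D (e := (y, z)) hz he hy hs
  have key : ∀ (m : ℕ) (x : Bool) (b : ℕ × ℕ), b ∈ D.S.boxes → n ≤ b.1 + b.2 + m →
      pipeLabel E (x, b) =
      if inIn z b ∧ inIn b a ∧ b ≠ a then
        Equiv.swap (pipeB D a) (pipeR D a) (pipeLabel D (x, b))
      else pipeLabel D (x, b) := by
    intro m
    induction m with
    | zero =>
      intro x b hb hn
      have := D.S.add_lt hb
      omega
    | succ m ih =>
      intro x b hb hn
      have hd := downOrRight_add x b
      have hbd := inIn_downOrRight x b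
      by_cases hdS : downOrRight x b ∈ D.S.boxes
      swap
      · rw [pipeLabel_of_notMem E (e := (x, b)) (by rw [hS]; exact hdS), hS,
          ← pipeLabel_of_notMem D (e := (x, b)) hdS]
        split_ifs with hq
        · rw [swap_of_notMem]
          intro hl
          have h := below_a (x, b) hb hl (inIn_add_lt hq.2.1 hq.2.2)
          exact hdS (D.S.nw_closed a ha _ _ h.1 h.2)
        · rfl
      have hE : pipeLabel E (x, b) = pipeLabel E
          (xor x (decide (E.fill (downOrRight x b) = Fill.plus)), downOrRight x b) := by
        rw [← pipeLabel_pipeStep E, pipeStep]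
        simp [hS, hdS]
      have hD : pipeLabel D (x, b) = pipeLabel D
          (xor x (decide (D.fill (downOrRight x b) = Fill.plus)), downOrRight x b) := by
        rw [← pipeLabel_pipeStep D, pipeStep]
        simp [hdS]
      rw [hE, ih _ _ hdS (by omega)]
      by_cases hda : downOrRight x b = a
      · have hba : inIn b a := hda ▸ hbd
        have hbne : b ≠ a := fun h => by rw [hda, h] at hd; omega
        have hlm : pipeLabel D (x, b) ∈ pipePair D a := by
          rw [hD, hda]
          exact (mem_pipePair_iff D a _).2 ⟨_, rfl⟩
        have hzb : inIn z b := above_z (x, b) hb hlm (by rw [hda] at hd; simp only; omega)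
        rw [if_neg (by simp [hda]), if_pos ⟨hzb, hba, hbne⟩, hD, hda, swap_a]
        simp [hfa]
      by_cases hdz : downOrRight x b = z
      · have hnz : ¬ inIn z b := fun h => by
          rw [hdz] at hd
          have := h.1
          have := h.2
          omega
        rw [if_neg (c := inIn z b ∧ inIn b a ∧ b ≠ a) (fun h => hnz h.1), hdz, if_pos ⟨⟨le_rfl, le_rfl⟩, hza, hne⟩, swap_z, hD, hdz]
        simp [hfz]
      have hfd := hfill _ hda hdz
      rw [show (xor x (decide (E.fill (downOrRight x b) = Fill.plus))) =
        (xor x (decide (D.fill (downOrRight x b) = Fill.plus))) by simp [hfd], ← hD]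
      by_cases hl : pipeLabel D (x, b) ∈ pipePair D a
      swap
      · rw [swap_of_notMem _ hl]
        simp
      refine if_congr ?_ rfl rfl
      constructor
      · rintro ⟨h1, h2, h3⟩
        have hs := inIn_add_lt h2 h3
        have hs' := inIn_add_lt h1 (Ne.symm hdz)
        refine ⟨above_z (x, b) hb hl (by simp only; omega), inIn_trans hbd h2, ?_⟩
        rintro rfl
        omega
      · rintro ⟨h1, h2, h3⟩
        exact ⟨inIn_trans h1 hbd, below_a (x, b) hb hl (inIn_add_lt h2 h3), hda⟩
  exact fun x b hb => key n x b hb (by omega)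

/-- If some edge at `b` changes its label when the tiles at `p` and `t` are switched, then
`b` lies in the rectangle spanned by `p` and `t`, on one of the two pipes through `t`. -/
lemma mem_rectangle_of_switch {n k : ℕ} (D E : Diagram n k) (hS : E.S = D.S) {p t : ℕ × ℕ}
    (hp : p ∈ D.S.boxes) (ht : t ∈ D.S.boxes) (hne : p ≠ t)
    (hpair : pipePair D p = pipePair D t)
    (hfp : E.fill p = Fill.plus ↔ ¬ D.fill p = Fill.plus)
    (hft : E.fill t = Fill.plus ↔ ¬ D.fill t = Fill.plus)
    (hfill : ∀ c : ℕ × ℕ, c ≠ p → c ≠ t → (E.fill c = Fill.plus ↔ D.fill c = Fill.plus))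
    {x : Bool} {b : ℕ × ℕ} (hb : b ∈ D.S.boxes) (hx : pipeLabel E (x, b) ≠ pipeLabel D (x, b)) :
    pipeLabel D (x, b) ∈ pipePair D t ∧ ((inIn p b ∧ inIn b t) ∨ (inIn t b ∧ inIn b p)) := by
  have aux : ∀ {a z : ℕ × ℕ}, pipeLabel E (x, b) = (if inIn z b ∧ inIn b a ∧ b ≠ a then
        Equiv.swap (pipeB D a) (pipeR D a) (pipeLabel D (x, b)) else pipeLabel D (x, b)) →
      pipeLabel D (x, b) ∈ pipePair D a ∧ inIn z b ∧ inIn b a := by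
    intro a z h
    split_ifs at h with hq
    · refine ⟨?_, hq.1, hq.2.1⟩
      by_contra hl
      simp only [pipePair, Finset.mem_insert, Finset.mem_singleton, not_or] at hl
      exact hx (h.trans (Equiv.swap_apply_of_ne_of_ne hl.1 hl.2))
    · exact absurd h hx
  obtain ⟨y, hy⟩ : ∃ y, pipeLabel D (y, t) = pipeLabel D (true, p) := by
    rw [← mem_pipePair_iff, ← hpair, mem_pipePair_iff]
    exact ⟨_, rfl⟩
  rcases le_total (p.1 + p.2) (t.1 + t.2) with hle | hle
  · have hpt : inIn p t := inIn_of_pipeLabel_eq D (e := (true, p)) (f := (y, t)) hp ht hy.symm hle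
    have h := aux (pipeLabel_of_switch D E hS ht hpt hne hpair hft hfp
      (fun c h h' => hfill c h' h) x b hb)
    exact ⟨h.1, Or.inl h.2⟩
  · have htp : inIn t p := inIn_of_pipeLabel_eq D (e := (y, t)) (f := (true, p)) ht hp hy hle
    have h := aux (pipeLabel_of_switch D E hS hp htp hne.symm hpair.symm hfp hft hfill x b hb)
    exact ⟨hpair ▸ h.1, Or.inr h.2⟩

lemma IsFlipPair.pipePair_eq {n k : ℕ} {D : Diagram n k} {p t : ℕ × ℕ} (h : IsFlipPair D p t) :
    IsStone D t ∧ pipePair D p = pipePair D t := by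
  obtain ⟨hp, hplus, -, w, ⟨hw, -, hwp, -, -, hpair, hin, -⟩, ht⟩ := h
  have hlt := inIn_add_lt hin hwp.symm
  have hsum : ∀ b c : ℕ × ℕ, p.1 + p.2 ≤ b.1 + b.2 → b.1 + b.2 < c.1 + c.2 →
      ((setFill D p Fill.white).fill c = Fill.plus ↔ D.fill c = Fill.plus) := by
    intro b c h1 h2
    have : c ≠ p := by
      rintro rfl
      omega
    simp [setFill, this]
  rw [pipePair_congr D (setFill D p Fill.white) rfl w (fun c => hsum w c hlt.le),
    pipePair_congr D (setFill D p Fill.white) rfl p (fun c => hsum p c le_rfl)] at hpair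
  rcases ht with rfl | ⟨-, ht, -, -, -, hpair', -⟩
  · refine ⟨⟨hw.1, ?_⟩, hpair.symm⟩
    have := hw.2
    simpa [setFill, hwp] using this
  · exact ⟨ht, hpair.symm.trans hpair'⟩

/-- In a corrective flip switching the plus `p` with the stone `t`,
letting `i`, `j` be the two pipes crossing at the crossing tile `t`, the only
stones that change color lie along pipes `i` and `j`, on the segments between
the plus and the crossing tile involved in the flip. -/
theorem corrective_flip_color_changes_along_pipes {n k : ℕ} (D D' : Diagram n k)
    (hB : BlackIffUncross D) (p t : ℕ × ℕ)
    (hpair : IsFlipPair D p t) (hD' : DEq D' (flipPlusWith D p t)) :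
    ∀ b ∈ D.S.boxes, D.fill b ≠ Fill.plus → D'.fill b ≠ Fill.plus →
      D.fill b ≠ D'.fill b →
        (pipeB D b = pipeB D t ∨ pipeB D b = pipeR D t ∨
          pipeR D b = pipeB D t ∨ pipeR D b = pipeR D t) ∧
        ((inIn p b ∧ inIn b t) ∨ (inIn t b ∧ inIn b p)) := by
  obtain ⟨ht, hpair'⟩ := hpair.pipePair_eq
  obtain ⟨hp, hplus, -⟩ := hpair
  have hne : p ≠ t := by
    rintro rfl
    exact ht.2 hplus
  intro b hb hDb hDb' hcol
  rw [hD'.2 b (by rw [hD'.1]; exact hb)] at hDb' hcol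
  set X := setFill (setFill D p Fill.white) t Fill.plus with hX
  have hchange : ∃ x, pipeLabel X (x, b) ≠ pipeLabel D (x, b) := by
    by_contra! hsame
    have h1 : pipeB X b = pipeB D b := hsame true
    have h2 : pipeR X b = pipeR D b := hsame false
    have hXb : X.fill b ≠ Fill.plus := fun h => hDb' (by simp [flipPlusWith, recolor, ← hX, h])
    have h3 := hB b hb
    apply hcol
    simp only [flipPlusWith, recolor, ← hX, h1, h2, if_neg hXb]
    split_ifs with h4
    · exact h3.2 ⟨hDb, h4⟩
    · have h5 : D.fill b ≠ Fill.black := fun h => h4 (h3.1 h).2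
      revert hDb h5
      cases D.fill b <;> simp
  obtain ⟨x, hx⟩ := hchange
  have h := mem_rectangle_of_switch D X rfl hp ht.1 hne hpair'
    (by simp [hX, setFill, hne, hplus]) (by simp [hX, setFill, ht.2])
    (fun c h h' => by simp [hX, setFill, h, h']) hb hx
  refine ⟨?_, h.2⟩
  have h' := h.1
  simp only [pipePair, Finset.mem_insert, Finset.mem_singleton, pipeLabel_eq_ite] at h'
  cases x
  · exact Or.inr (Or.inr h')
  · rcases h' with h' | h'
    · exact Or.inl h'
    · exact Or.inr (Or.inl h')

end GoPaper
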